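/- Let A be a sequence algebra and X an essential homogeneous normed A-module. Then the completion X̄ of X is again an essential homogeneous (Banach) A-module. -/

import Mathlib

noncomputable section

open Filter Topology

/-- A coisometric (quotient) bounded operator between complex normed spaces. -/
def IsCoisometry {Y X : Type} [NormedAddCommGroup Y] [NormedSpace ℂ Y]
    [NormedAddCommGroup X] [NormedSpace ℂ X] (τ : Y →L[ℂ] X) : Prop :=
  (∀ y : Y, ‖τ y‖ ≤ ‖y‖) ∧ ∀ x : X, ∀ ε : ℝ, 0 < ε → ∃ y : Y, τ y = x ∧ ‖y‖ < ‖x‖ + ε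

/-- Extreme (metric) projectivity in the category Nor of all complex normed spaces. -/
def ExtremelyProjectiveNor (P : Type) [NormedAddCommGroup P] [NormedSpace ℂ P] : Prop :=
  ∀ (Y X : Type) [NormedAddCommGroup Y] [NormedSpace ℂ Y]
    [NormedAddCommGroup X] [NormedSpace ℂ X],
    ∀ τ : Y →L[ℂ] X, IsCoisometry τ →
      ∀ φ : P →L[ℂ] X, ∀ ε : ℝ, 0 < ε →
        ∃ ψ : P →L[ℂ] Y, τ.comp ψ = φ ∧ ‖ψ‖ < ‖φ‖ + ε

/-- Topological projectivity in Nor. -/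
def TopologicallyProjectiveNor (P : Type) [NormedAddCommGroup P] [NormedSpace ℂ P] : Prop :=
  ∀ (Y X : Type) [NormedAddCommGroup Y] [NormedSpace ℂ Y]
    [NormedAddCommGroup X] [NormedSpace ℂ X],
    ∀ τ : Y →L[ℂ] X, IsCoisometry τ →
      ∀ φ : P →L[ℂ] X, ∃ ψ : P →L[ℂ] Y, τ.comp ψ = φ

/-- A (contractive, non-degenerate in no way assumed) normed left module over a
(not necessarily unital) complex normed algebra `A`. -/
structure NormedMod (A : Type) [NonUnitalNormedRing A] [NormedSpace ℂ A] : Type 1 where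
  X : Type
  [grp : NormedAddCommGroup X]
  [sp : NormedSpace ℂ X]
  smul : A → X → X
  smul_add : ∀ (a : A) (x y : X), smul a (x + y) = smul a x + smul a y
  add_smul : ∀ (a b : A) (x : X), smul (a + b) x = smul a x + smul b x
  smul_csmul : ∀ (c : ℂ) (a : A) (x : X), smul a (c • x) = c • smul a x
  csmul_smul : ∀ (c : ℂ) (a : A) (x : X), smul (c • a) x = c • smul a x
  mul_smul : ∀ (a b : A) (x : X), smul (a * b) x = smul a (smul b x)
  norm_smul_le : ∀ (a : A) (x : X), ‖smul a x‖ ≤ ‖a‖ * ‖x‖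

attribute [instance] NormedMod.grp NormedMod.sp

variable {A : Type} [NonUnitalNormedRing A] [NormedSpace ℂ A]
  [IsScalarTower ℂ A A] [SMulCommClass ℂ A A]

/-- Bounded `A`-module morphism property for a bounded operator between the underlying spaces. -/
def IsMor (M N : NormedMod A) (f : M.X →L[ℂ] N.X) : Prop :=
  ∀ (a : A) (x : M.X), f (M.smul a x) = N.smul a (f x)

/-- Extreme (metric) projectivity of a normed `A`-module with respect to a class `K`
of normed `A`-modules. -/
def ExtremelyProjective (P : NormedMod A) (K : NormedMod A → Prop) : Prop :=
  ∀ (MY MX : NormedMod A), K MY → K MX →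
    ∀ τ : MY.X →L[ℂ] MX.X, IsMor MY MX τ → IsCoisometry τ →
      ∀ φ : P.X →L[ℂ] MX.X, IsMor P MX φ → ∀ ε : ℝ, 0 < ε →
        ∃ ψ : P.X →L[ℂ] MY.X, IsMor P MY ψ ∧ τ.comp ψ = φ ∧ ‖ψ‖ < ‖φ‖ + ε

/-- Topological projectivity of a normed `A`-module with respect to a class `K`. -/
def TopologicallyProjective (P : NormedMod A) (K : NormedMod A → Prop) : Prop :=
  ∀ (MY MX : NormedMod A), K MY → K MX →
    ∀ τ : MY.X →L[ℂ] MX.X, IsMor MY MX τ → IsCoisometry τ →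
      ∀ φ : P.X →L[ℂ] MX.X, IsMor P MX φ →
        ∃ ψ : P.X →L[ℂ] MY.X, IsMor P MY ψ ∧ τ.comp ψ = φ

/-- A sequence algebra: a normed algebra `A` realized (injectively, by `coords`) as an
algebra of complex sequences with coordinatewise operations, containing the elements
`p n` (the sequences with a single entry `1` in position `n`, which span `c₀₀`) so that
`c₀₀` is dense and `‖p n‖ = 1`. -/
structure SequenceAlgebra (A : Type) [NonUnitalNormedRing A] [NormedSpace ℂ A] : Type where
  coords : A →ₗ[ℂ] (ℕ → ℂ)
  coords_injective : Function.Injective coords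
  coords_mul : ∀ a b : A, coords (a * b) = coords a * coords b
  p : ℕ → A
  coords_p : ∀ n : ℕ, coords (p n) = fun m => if m = n then (1 : ℂ) else 0
  norm_p : ∀ n : ℕ, ‖p n‖ = 1
  dense_c00 : Dense (↑(Submodule.span ℂ (Set.range p)) : Set A)

variable (SA : SequenceAlgebra A)

/-- The action of a fixed `a : A` as a `ℂ`-linear map on a normed `A`-module. -/
def NormedMod.smulLM (M : NormedMod A) (a : A) : M.X →ₗ[ℂ] M.X where
  toFun := M.smul a
  map_add' := M.smul_add a
  map_smul' := fun c x => M.smul_csmul c a x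

/-- The `n`-th coordinate subspace `Xₙ = {pⁿ · x : x ∈ X}` of a normed `A`-module. -/
def coordSub (M : NormedMod A) (n : ℕ) : Submodule ℂ M.X :=
  LinearMap.range (M.smulLM (SA.p n))

/-- A normed `A`-module is essential (non-degenerate) if the closed linear span of
`{a · x}` is everything. -/
def NormedMod.Essential (M : NormedMod A) : Prop :=
  Dense (↑(Submodule.span ℂ {y : M.X | ∃ (a : A) (x : M.X), y = M.smul a x}) : Set M.X)

/-- Homogeneity: the norm of an element is monotonely determined by the norms of
its coordinates. -/
def Homogeneous (M : NormedMod A) : Prop :=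
  ∀ x y : M.X, (∀ n : ℕ, ‖M.smul (SA.p n) x‖ ≤ ‖M.smul (SA.p n) y‖) → ‖x‖ ≤ ‖y‖

/-- An element is finite if its coordinates eventually vanish. -/
def FiniteElt (M : NormedMod A) (x : M.X) : Prop :=
  ∃ N : ℕ, ∀ n : ℕ, N ≤ n → M.smul (SA.p n) x = 0

/-- A module has finite type if all its elements are finite, i.e. `X = X₀₀`. -/
def FiniteType (M : NormedMod A) : Prop :=
  ∀ x : M.X, FiniteElt SA M x


/-- `N` is a completion of `M`: `N` is a Banach `A`-module in which `M` embeds by an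
isometric module morphism with dense range. -/
def IsCompletionOf (M N : NormedMod A) : Prop :=
  CompleteSpace N.X ∧
    ∃ ι : M.X →L[ℂ] N.X, IsMor M N ι ∧ (∀ x : M.X, ‖ι x‖ = ‖x‖) ∧ DenseRange ι

set_option linter.unusedSectionVars false

/-- The module action as a bounded bilinear map. -/
def NormedMod.actCLM (M : NormedMod A) : A →L[ℂ] M.X →L[ℂ] M.X :=
  LinearMap.mkContinuous₂
    (LinearMap.mk₂ ℂ M.smul M.add_smul M.csmul_smul M.smul_add M.smul_csmul) 1
    fun a x => by simpa using M.norm_smul_le a x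

theorem NormedMod.actCLM_apply (M : NormedMod A) (a : A) (x : M.X) :
    M.actCLM a x = M.smul a x := rfl

theorem SequenceAlgebra.p_mul_p (m n : ℕ) :
    SA.p m * SA.p n = if m = n then SA.p n else 0 := by
  apply SA.coords_injective
  rw [SA.coords_mul]
  split_ifs with h
  · subst h
    ext k
    simp [SA.coords_p]
  · ext k
    simp only [SA.coords_p, Pi.mul_apply, map_zero, Pi.zero_apply]
    grind

/-- The `n`-th coordinate projection of a normed module. -/
def coordProj (M : NormedMod A) (n : ℕ) : M.X →L[ℂ] M.X := M.actCLM (SA.p n)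

/-- The sum of the first `k` coordinate projections. -/
def partialProj (M : NormedMod A) (k : ℕ) : M.X →L[ℂ] M.X :=
  ∑ n ∈ Finset.range k, coordProj SA M n

theorem partialProj_apply (M : NormedMod A) (k : ℕ) (x : M.X) :
    partialProj SA M k x = ∑ n ∈ Finset.range k, coordProj SA M n x := by
  simp [partialProj]

theorem norm_coordProj_le (M : NormedMod A) (n : ℕ) (x : M.X) :
    ‖coordProj SA M n x‖ ≤ ‖x‖ := by
  simpa [coordProj, NormedMod.actCLM_apply, SA.norm_p] using M.norm_smul_le (SA.p n) x

theorem coordProj_coordProj (M : NormedMod A) (m n : ℕ) (x : M.X) :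
    coordProj SA M m (coordProj SA M n x) = if m = n then coordProj SA M n x else 0 := by
  have h : coordProj SA M m (coordProj SA M n x) = M.actCLM (SA.p m * SA.p n) x :=
    (M.mul_smul _ _ _).symm
  rw [h, SA.p_mul_p]
  split_ifs
  · rfl
  · simp

theorem coordProj_sum_smul (M : NormedMod A) (m k : ℕ) (c : ℕ → ℂ) (x : M.X) :
    coordProj SA M m (∑ n ∈ Finset.range k, c n • coordProj SA M n x) =
      if m < k then c m • coordProj SA M m x else 0 := by
  simp [map_sum, coordProj_coordProj]

theorem dense_setOf_partialProj_eq (M : NormedMod A) (hess : M.Essential) :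
    Dense {z : M.X | ∃ k, partialProj SA M k z = z} := by
  set F : Submodule ℂ M.X := Submodule.span ℂ {y | ∃ n x, y = coordProj SA M n x} with hF
  have hact (a : A) (x : M.X) : M.smul a x ∈ F.topologicalClosure := by
    have hc : Continuous fun a => M.actCLM a x := by fun_prop
    refine SA.dense_c00.induction (P := fun a => M.actCLM a x ∈ F.topologicalClosure) ?_
      (F.isClosed_topologicalClosure.preimage hc) a
    intro b hb
    induction hb using Submodule.span_induction with
    | mem b hb =>
      obtain ⟨n, rfl⟩ := hb
      exact F.le_topologicalClosure (Submodule.subset_span ⟨n, x, rfl⟩)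
    | zero => simp
    | add b c _ _ hb hc => simpa using add_mem hb hc
    | smul t b _ hb => simpa using Submodule.smul_mem _ t hb
  have hdense : Dense (F : Set M.X) := by
    have h : Dense (F.topologicalClosure : Set M.X) := by
      refine hess.mono (Submodule.span_le.2 ?_)
      rintro _ ⟨a, x, rfl⟩
      exact hact a x
    rwa [Submodule.topologicalClosure_coe, dense_closure] at h
  refine hdense.mono fun z hz => ?_
  suffices h : ∃ k, ∀ m ≥ k, partialProj SA M m z = z from
    let ⟨k, hk⟩ := h; ⟨k, hk k le_rfl⟩
  induction hz using Submodule.span_induction with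
  | mem z hz =>
    obtain ⟨n, x, rfl⟩ := hz
    refine ⟨n + 1, fun m hm => ?_⟩
    have : n < m := hm
    simp [partialProj_apply, coordProj_coordProj, this]
  | zero => exact ⟨0, by simp⟩
  | add y z _ _ hy hz =>
    obtain ⟨k, hk⟩ := hy
    obtain ⟨l, hl⟩ := hz
    refine ⟨max k l, fun m hm => ?_⟩
    rw [map_add, hk m (le_of_max_le_left hm), hl m (le_of_max_le_right hm)]
  | smul t z _ hz =>
    obtain ⟨k, hk⟩ := hz
    exact ⟨k, fun m hm => by rw [map_smul, hk m hm]⟩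

theorem Homogeneous.norm_partialProj_le_add {M : NormedMod A} (hhom : Homogeneous SA M)
    {x y : M.X} {δ : ℝ} (hδ : 0 < δ)
    (h : ∀ n, ‖coordProj SA M n x‖ ≤ ‖coordProj SA M n y‖ + δ) (k : ℕ) :
    ‖partialProj SA M k x‖ ≤ ‖y‖ + k * δ := by
  set c : ℕ → ℝ := fun n => ‖coordProj SA M n y‖ / (‖coordProj SA M n y‖ + δ) with hc
  have hpos (n : ℕ) : 0 < ‖coordProj SA M n y‖ + δ := by positivity
  set w : M.X := ∑ n ∈ Finset.range k, (c n : ℂ) • coordProj SA M n x with hw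
  have hwy : ‖w‖ ≤ ‖y‖ := by
    refine hhom w y fun m => ?_
    change ‖coordProj SA M m w‖ ≤ ‖coordProj SA M m y‖
    rw [hw, coordProj_sum_smul SA M m k fun n => (c n : ℂ)]
    split_ifs
    · have hcm : 0 ≤ c m := by positivity
      rw [norm_smul, Complex.norm_real, Real.norm_of_nonneg hcm]
      calc c m * ‖coordProj SA M m x‖ ≤ c m * (‖coordProj SA M m y‖ + δ) := by
            gcongr
            exact h m
        _ = ‖coordProj SA M m y‖ := div_mul_cancel₀ _ (hpos m).ne'
    · simp
  have hdiff : ‖partialProj SA M k x - w‖ ≤ k * δ := by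
    rw [partialProj_apply, hw, ← Finset.sum_sub_distrib]
    refine (norm_sum_le_of_le (n := fun _ => δ) (Finset.range k) fun n _ => ?_).trans (by simp)
    have h1 : 1 - c n = δ / (‖coordProj SA M n y‖ + δ) := by
      have := (hpos n).ne'
      simp only [hc]
      field_simp
      ring
    have h2 : coordProj SA M n x - (c n : ℂ) • coordProj SA M n x
        = ((1 - c n : ℝ) : ℂ) • coordProj SA M n x := by
      push_cast
      rw [sub_smul, one_smul]
    have h3 : 0 ≤ 1 - c n := by
      rw [h1]
      positivity
    rw [h2, norm_smul, Complex.norm_real, Real.norm_of_nonneg h3]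
    calc (1 - c n) * ‖coordProj SA M n x‖ ≤ (1 - c n) * (‖coordProj SA M n y‖ + δ) := by
          gcongr
          exact h n
      _ = δ := by rw [h1, div_mul_cancel₀ _ (hpos n).ne']
  have := norm_le_norm_add_norm_sub' (partialProj SA M k x) w
  linarith

theorem IsMor.map_coordProj {M N : NormedMod A} {ι : M.X →L[ℂ] N.X} (hι : IsMor M N ι)
    (n : ℕ) (x : M.X) : ι (coordProj SA M n x) = coordProj SA N n (ι x) :=
  hι _ _

theorem IsMor.map_partialProj {M N : NormedMod A} {ι : M.X →L[ℂ] N.X} (hι : IsMor M N ι)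
    (k : ℕ) (x : M.X) : ι (partialProj SA M k x) = partialProj SA N k (ι x) := by
  simp [partialProj_apply, hι.map_coordProj SA]

theorem IsMor.essential {M N : NormedMod A} {ι : M.X →L[ℂ] N.X} (hι : IsMor M N ι)
    (hdense : DenseRange ι) (hess : M.Essential) : N.Essential := by
  refine (hdense.dense_image ι.continuous hess).mono ?_
  rintro _ ⟨z, hz, rfl⟩
  refine (Submodule.span_le (p := (Submodule.span ℂ _).comap (ι : M.X →ₗ[ℂ] N.X))).2 ?_ hz
  rintro _ ⟨a, x, rfl⟩
  exact Submodule.subset_span ⟨a, ι x, hι a x⟩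

theorem Homogeneous.norm_partialProj_le_of_denseRange {M N : NormedMod A}
    (hhom : Homogeneous SA M) {ι : M.X →L[ℂ] N.X} (hι : IsMor M N ι)
    (hnorm : ∀ x, ‖ι x‖ = ‖x‖) (hdense : DenseRange ι) {x y : N.X}
    (h : ∀ n, ‖coordProj SA N n x‖ ≤ ‖coordProj SA N n y‖) (k : ℕ) :
    ‖partialProj SA N k x‖ ≤ ‖y‖ := by
  have key (δ : ℝ) (hδ : 0 < δ) :
      ‖partialProj SA N k x‖ ≤ ‖y‖ + δ * (1 + 3 * k) := by
    obtain ⟨u, hu⟩ := hdense.exists_dist_lt x hδ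
    obtain ⟨v, hv⟩ := hdense.exists_dist_lt y hδ
    rw [dist_eq_norm] at hu hv
    have hcu (n : ℕ) : ‖coordProj SA N n x - coordProj SA N n (ι u)‖ ≤ δ := by
      rw [← map_sub]
      exact (norm_coordProj_le SA N n _).trans hu.le
    have hcv (n : ℕ) : ‖coordProj SA N n y - coordProj SA N n (ι v)‖ ≤ δ := by
      rw [← map_sub]
      exact (norm_coordProj_le SA N n _).trans hv.le
    have huv := hhom.norm_partialProj_le_add SA (x := u) (y := v) (δ := 2 * δ) (by positivity)
      (fun n => by
        rw [← hnorm, ← hnorm (coordProj SA M n v), hι.map_coordProj SA, hι.map_coordProj SA]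
        have h1 := norm_le_norm_add_norm_sub (coordProj SA N n x) (coordProj SA N n (ι u))
        have h2 := norm_le_norm_add_norm_sub' (coordProj SA N n y) (coordProj SA N n (ι v))
        linarith [h n, hcu n, hcv n]) k
    rw [← hnorm, ← hnorm v, hι.map_partialProj SA] at huv
    have hdiff : ‖partialProj SA N k x - partialProj SA N k (ι u)‖ ≤ k * δ := by
      rw [partialProj_apply, partialProj_apply, ← Finset.sum_sub_distrib]
      exact (norm_sum_le_of_le _ fun n _ => hcu n).trans (by simp)
    have h1 := norm_le_norm_add_norm_sub' (partialProj SA N k x) (partialProj SA N k (ι u))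
    have h2 := norm_le_norm_add_norm_sub y (ι v)
    linarith
  have hk : (0 : ℝ) < 1 + 3 * k := by positivity
  refine le_of_forall_pos_le_add fun ε hε => ?_
  simpa [div_mul_cancel₀ _ hk.ne'] using key (ε / (1 + 3 * k)) (by positivity)

theorem Homogeneous.of_denseRange {M N : NormedMod A} (hess : M.Essential)
    (hhom : Homogeneous SA M) {ι : M.X →L[ℂ] N.X} (hι : IsMor M N ι)
    (hnorm : ∀ x, ‖ι x‖ = ‖x‖) (hdense : DenseRange ι) : Homogeneous SA N := by
  intro x y h
  refine le_of_forall_pos_le_add fun ε hε => ?_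
  obtain ⟨_, ⟨z, ⟨k, hk⟩, rfl⟩, hz⟩ := (hdense.dense_image ι.continuous
    (dense_setOf_partialProj_eq SA M hess)).exists_dist_lt x (half_pos hε)
  rw [dist_eq_norm] at hz
  have hkz : partialProj SA N k (ι z) = ι z := by rw [← hι.map_partialProj SA, hk]
  have h1 := hhom.norm_partialProj_le_of_denseRange SA hι hnorm hdense (x := x) (y := y) h k
  have h2 := hhom.norm_partialProj_le_of_denseRange SA hι hnorm hdense
    (x := x - ι z) (fun _ => le_rfl) k
  rw [map_sub, hkz] at h2
  have h3 := norm_le_norm_add_norm_sub' x (ι z)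
  have h4 := norm_le_norm_add_norm_sub (partialProj SA N k x) (ι z)
  linarith

/-- Proposition 1.6: the completion of an essential homogeneous normed module over a
sequence algebra is again an essential homogeneous (Banach) module. -/
theorem completion_essential_homogeneous
    (M : NormedMod A) (hess : M.Essential) (hhom : Homogeneous SA M)
    (N : NormedMod A) (hN : IsCompletionOf M N) :
    N.Essential ∧ Homogeneous SA N := by
  obtain ⟨_, ι, hι, hnorm, hdense⟩ := hN
  exact ⟨hι.essential hdense hess, hhom.of_denseRange SA hess hι hnorm hdense⟩

end
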